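/- arXiv:1411.4364 — 6 statements merged into one kernel-verified Lean document; each statement's English description precedes it below -/
import Mathlib

section
/- For all integers s ≥ 10 and q with s + 3 ≤ q ≤ 2·s − 7, Lazebnik's conjecture is false for the pair (s,q): there exist a positive integer n divisible by s and a graph G with n vertices and the same number of edges as the Turán graph T_s(n) such that P_G(q) > P_{T_s(n)}(q). -/
open SimpleGraph

/-- Number of proper `q`-colorings of a graph on `Fin n`. -/
noncomputable def numColorings (q : ℕ) {n : ℕ} (G : SimpleGraph (Fin n)) : ℕ :=
  Nat.card { f : Fin n → Fin q // ∀ v w, G.Adj v w → f v ≠ f w }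

/-- Number of edges of a graph on `Fin n`. -/
noncomputable def numEdges {n : ℕ} (G : SimpleGraph (Fin n)) : ℕ :=
  Nat.card G.edgeSet

/-- Lazebnik's conjecture is false for the pair `(s, q)`: for some `n` divisible by `s`,
some graph with `n` vertices and as many edges as the Turán graph `T_s(n)` has strictly
more proper `q`-colorings than `T_s(n)`. -/
def LazebnikFalseFor (s q : ℕ) : Prop :=
  ∃ n : ℕ, 0 < n ∧ s ∣ n ∧
    ∃ G : SimpleGraph (Fin n),
      numEdges G = numEdges (turanGraph n s) ∧
      numColorings q (turanGraph n s) < numColorings q G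

lemma exists_le_numEdges_eq {n k : ℕ} (H : SimpleGraph (Fin n)) (hk : k ≤ numEdges H) :
    ∃ G ≤ H, numEdges G = k := by
  classical
  rw [numEdges, Nat.card_eq_fintype_card, ← edgeFinset_card] at hk
  obtain ⟨S, hS, rfl⟩ := Finset.exists_subset_card_eq hk
  have hSH : (S : Set (Sym2 (Fin n))) ⊆ H.edgeSet := fun e he =>
    mem_edgeFinset.1 (hS (Finset.mem_coe.1 he))
  have hE : (fromEdgeSet (S : Set (Sym2 (Fin n)))).edgeSet = S := by
    rw [edgeSet_fromEdgeSet, sdiff_eq_left, Set.disjoint_left]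
    exact fun e he => H.not_isDiag_of_mem_edgeSet (hSH he)
  refine ⟨fromEdgeSet S, ?_, ?_⟩
  · rw [← edgeSet_subset_edgeSet, hE]
    exact hSH
  · rw [numEdges, hE]
    simp

lemma numColorings_anti (q : ℕ) {n : ℕ} {G H : SimpleGraph (Fin n)} (h : G ≤ H) :
    numColorings q H ≤ numColorings q G :=
  Nat.card_le_card_of_injective
    (Subtype.map id fun _ hf v w hvw => hf v w (h hvw))
    (Subtype.map_injective _ Function.injective_id)

lemma two_mul_numEdges_turanGraph_le {s : ℕ} (hs : 0 < s) (m : ℕ) :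
    2 * numEdges (turanGraph (s * m) s) + s * m ^ 2 ≤ (s * m) ^ 2 := by
  obtain ⟨r, rfl⟩ := Nat.exists_eq_succ_of_ne_zero hs.ne'
  rw [numEdges, Nat.card_eq_fintype_card, ← edgeFinset_card]
  have h := mul_card_edgeFinset_turanGraph_le (n := r.succ * m) (r := r.succ)
  rw [Nat.succ_sub_one] at h
  refine le_of_mul_le_mul_left (a := r.succ) ?_ r.succ_pos
  rw [Nat.succ_eq_add_one] at h ⊢
  linarith

lemma two_mul_le_two_pow (k : ℕ) : 2 * k ≤ 2 ^ k := by
  induction k with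
  | zero => simp
  | succ k ih =>
    have := Nat.one_le_two_pow (n := k)
    rw [pow_succ]
    rcases k with _ | k
    · simp
    · omega

lemma prod_card_fiber_le {s q : ℕ} (g : Fin q → Fin s) :
    2 ^ s * ∏ i, Fintype.card {c // g c = i} ≤ 2 ^ q := by
  calc 2 ^ s * ∏ i, Fintype.card {c // g c = i}
      = ∏ i, 2 * Fintype.card {c // g c = i} := by simp [Finset.prod_mul_distrib]
    _ ≤ ∏ i, 2 ^ Fintype.card {c // g c = i} :=
        Finset.prod_le_prod' fun i _ => two_mul_le_two_pow _
    _ = 2 ^ q := by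
        rw [Finset.prod_pow_eq_pow_sum, ← Fintype.card_sigma,
          Fintype.card_congr (Equiv.sigmaFiberEquiv g), Fintype.card_fin]

/-- Each coloring of the Turán graph is compatible with an assignment `g` of the colors to
the parts, and at most `2 ^ ((q - s) * m)` colorings are compatible with a given `g`. -/
lemma numColorings_turanGraph_le {s : ℕ} (hs : 0 < s) (q m : ℕ) :
    2 ^ (s * m) * numColorings q (turanGraph (s * m) s) ≤ s ^ q * 2 ^ (q * m) := by
  classical
  let p : Fin (s * m) → Fin s := fun v => ⟨v % s, Nat.mod_lt _ hs⟩
  have hcover : numColorings q (turanGraph (s * m) s) ≤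
      Nat.card (Σ g : Fin q → Fin s, ∀ v, {c // g c = p v}) := by
    have key (f : {f : Fin (s * m) → Fin q //
        ∀ v w, (turanGraph (s * m) s).Adj v w → f v ≠ f w}) :
        ∃ g : Fin q → Fin s, ∀ v, g (f.1 v) = p v := by
      have hfac : p.FactorsThrough f.1 := by
        intro v w hvw
        by_contra hne
        exact f.2 v w (fun h => hne (Fin.ext h)) hvw
      exact ⟨Function.extend f.1 p fun _ => ⟨0, hs⟩, fun v => hfac.extend_apply _ v⟩
    choose g hg using key
    refine Nat.card_le_card_of_injective (fun f => ⟨g f, fun v => ⟨f.1 v, hg f v⟩⟩) ?_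
    intro f f' h
    have hval := congrArg
      (fun x : Σ g : Fin q → Fin s, ∀ v, {c // g c = p v} => fun v => (x.2 v).1) h
    exact Subtype.ext hval
  refine (Nat.mul_le_mul_left _ hcover).trans ?_
  rw [Nat.card_eq_fintype_card, Fintype.card_sigma, Finset.mul_sum]
  calc _ ≤ ∑ _g : Fin q → Fin s, 2 ^ (q * m) := by
        refine Finset.sum_le_sum fun g _ => ?_
        have hprod : Fintype.card (∀ v, {c // g c = p v}) =
            (∏ i, Fintype.card {c // g c = i}) ^ m := by
          rw [Fintype.card_pi]
          let e : Fin m × Fin s ≃ Fin (s * m) := finProdFinEquiv.trans (finCongr (mul_comm m s))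
          have he (x : Fin m × Fin s) : p (e x) = x.2 := by
            apply Fin.ext
            simp [p, e, Nat.mod_eq_of_lt x.2.2]
          rw [← e.prod_comp, Fintype.prod_prod_type]
          simp only [he, Finset.prod_const, Finset.card_univ, Fintype.card_fin]
        rw [hprod, pow_mul, pow_mul, ← mul_pow]
        exact Nat.pow_le_pow_left (prod_card_fiber_le g) m
    _ = s ^ q * 2 ^ (q * m) := by simp

lemma two_mul_numEdges_comap_top {n : ℕ} {ι : Type*} [DecidableEq ι] (p : Fin n → ι)
    (c : Fin n → ℕ) (hc : ∀ v, Fintype.card {w // p w = p v} = c v) :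
    2 * numEdges ((⊤ : SimpleGraph ι).comap p) + ∑ v, c v = n ^ 2 := by
  classical
  rw [numEdges, Nat.card_eq_fintype_card, ← edgeFinset_card, ← sum_degrees_eq_twice_card_edges,
    ← Finset.sum_add_distrib]
  have h (v : Fin n) : ((⊤ : SimpleGraph ι).comap p).degree v + c v = n := by
    rw [← hc, Fintype.card_subtype, ← card_neighborFinset_eq_degree]
    have := Finset.card_filter_add_card_filter_not (s := Finset.univ) (fun w => p w = p v)
    rw [Finset.card_univ, Fintype.card_fin] at this
    rw [add_comm]
    convert this using 3
    ext w
    simp [eq_comm]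
  simp [h, sq]

/-- A complete multipartite graph with `t` parts of size `A` and `u` parts of size `B`. -/
lemma exists_multipartite {t u A B n : ℕ} (hn : t * A + u * B = n) :
    ∃ H : SimpleGraph (Fin n),
      2 * numEdges H + (t * A ^ 2 + u * B ^ 2) = n ^ 2 ∧
      2 ^ (t * A) ≤ numColorings (2 * t + u) H := by
  classical
  subst hn
  let X := (Fin t × Fin A) ⊕ (Fin u × Fin B)
  let e : Fin (t * A + u * B) ≃ X := (Fintype.equivFinOfCardEq (by simp [X])).symm
  let p : X → Fin t ⊕ Fin u := Sum.map Prod.fst Prod.fst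
  refine ⟨(⊤ : SimpleGraph (Fin t ⊕ Fin u)).comap (p ∘ e), ?_, ?_⟩
  · have hfiber (x : X) :
        Fintype.card {y // p y = p x} = Sum.elim (fun _ => A) (fun _ => B) x := by
      rw [Fintype.card_subtype, Finset.card_filter, Fintype.sum_sum_type, Fintype.sum_prod_type,
        Fintype.sum_prod_type]
      rcases x with ⟨i, a⟩ | ⟨i, a⟩ <;> simp [p]
    rw [← two_mul_numEdges_comap_top (p ∘ e) (fun v => Sum.elim (fun _ => A) (fun _ => B) (e v))]
    · rw [e.sum_comp (Sum.elim (fun _ => A) (fun _ => B))]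
      simp [X, sq, mul_assoc]
    · intro v
      rw [← hfiber]
      exact Fintype.card_congr (e.subtypeEquiv fun _ => Iff.rfl)
  · let col : (Fin t × Bool) ⊕ Fin u ≃ Fin (2 * t + u) :=
      Fintype.equivFinOfCardEq (by simp [mul_comm])
    let paint (b : Fin t × Fin A → Bool) : X → (Fin t × Bool) ⊕ Fin u :=
      Sum.map (fun x => (x.1, b x)) Prod.fst
    have hpaint (b) (x : X) : Sum.map Prod.fst id (paint b x) = p x := by
      rcases x with x | x <;> rfl
    have hcard : 2 ^ (t * A) = Nat.card (Fin t × Fin A → Bool) := by simp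
    rw [hcard]
    refine Nat.card_le_card_of_injective
      (fun b => ⟨fun v => col (paint b (e v)), fun v w hvw h => hvw ?_⟩) ?_
    · simp only [Function.comp_apply, ← hpaint b, col.injective h]
    · intro b b' h
      funext x
      have := congrFun (congrArg Subtype.val h) (e.symm (Sum.inl x))
      simpa [paint] using this

/-- For `s ≥ 10` and `s + 3 ≤ q ≤ 2s − 7`, Lazebnik's conjecture is false for `(s,q)`. -/
theorem lazebnik_false_small_range (s q : ℕ) (hs : 10 ≤ s)
    (h1 : s + 3 ≤ q) (h2 : q ≤ 2 * s - 7) :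
    LazebnikFalseFor s q := by
  obtain ⟨t, rfl⟩ : ∃ t, q = s + 1 + t := ⟨q - s - 1, by omega⟩
  obtain ⟨u, hu⟩ : ∃ u, s + 1 = t + u := ⟨s + 1 - t, by omega⟩
  have ht2 : 2 ≤ t := by omega
  have hu9 : 9 ≤ u := by omega
  obtain ⟨w, rfl⟩ : ∃ w, u = w + 2 := ⟨u - 2, by omega⟩
  obtain rfl : s = t + w + 1 := by omega
  -- The parts have sizes `A` and `B`, a perturbation of the ratio `(t + 1) / t : w / (w + 2)`.
  set q := t + w + 1 + 1 + t with hq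
  set s := t + w + 1 with hsdef
  set N := s * q with hN
  set c := 3 * (w + 2 + 2 * t) with hc
  set m := t * (w + 2) * (c * N) with hm
  set A := (w + 2) * (((t + 1) * c + 1) * N) with hA
  obtain ⟨b, hb⟩ : ∃ b, b + 1 = w * c :=
    ⟨w * c - 1, Nat.sub_add_cancel (Nat.mul_pos (by omega) (by omega))⟩
  set B := t * (b * N) with hB
  have hN0 : 0 < N := Nat.mul_pos (by omega) (by omega)
  have hm0 : 0 < m := by positivity
  have hcount : t * A + (w + 2) * B = s * m := by
    have : ((t + 1) * c + 1) + b = (t + w + 1) * c := by linarith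
    calc t * A + (w + 2) * B = t * (w + 2) * N * (((t + 1) * c + 1) + b) := by ring
      _ = s * m := by rw [this]; ring
  have hsq : t * A ^ 2 + (w + 2) * B ^ 2 ≤ s * m ^ 2 := by
    have key : (w + 2) * ((t + 1) * c + 1) ^ 2 + t * b ^ 2 ≤
        (t + w + 1) * (t * (w + 2) * c ^ 2) := by
      have h : w + 2 + 4 * t + 1 ≤ t * (w + 2) := by
        obtain ⟨t, rfl⟩ := Nat.exists_eq_add_of_le ht2
        obtain ⟨w, rfl⟩ : ∃ x, w = 7 + x := ⟨w - 7, by omega⟩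
        nlinarith
      have h' := Nat.mul_le_mul_left (c ^ 2) h
      have hlin : 2 * c * (w + 2 + 2 * t) + (w + 2 + t) ≤ c ^ 2 := by
        rw [hc]
        nlinarith
      zify at h' hlin hb ⊢
      rw [eq_sub_of_add_eq hb]
      linarith
    calc t * A ^ 2 + (w + 2) * B ^ 2
        = t * (w + 2) * N ^ 2 * ((w + 2) * ((t + 1) * c + 1) ^ 2 + t * b ^ 2) := by ring
      _ ≤ t * (w + 2) * N ^ 2 * ((t + w + 1) * (t * (w + 2) * c ^ 2)) :=
          Nat.mul_le_mul_left _ key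
      _ = s * m ^ 2 := by ring
  obtain ⟨H, hH, hcol⟩ := exists_multipartite hcount
  have hT := two_mul_numEdges_turanGraph_le (s := s) (by omega) m
  obtain ⟨G, hGH, hG⟩ := exists_le_numEdges_eq (k := numEdges (turanGraph (s * m) s)) H (by omega)
  refine ⟨s * m, Nat.mul_pos (by omega) hm0, Dvd.intro _ rfl, G, hG, ?_⟩
  have hqt : 2 * t + (w + 2) = q := by omega
  rw [hqt] at hcol
  refine lt_of_lt_of_le ?_ (hcol.trans (numColorings_anti q hGH))
  refine Nat.lt_of_mul_lt_mul_left (a := 2 ^ (s * m)) ?_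
  calc 2 ^ (s * m) * numColorings q (turanGraph (s * m) s)
      ≤ s ^ q * 2 ^ (q * m) := numColorings_turanGraph_le (by omega) q m
    _ < (2 ^ s) ^ q * 2 ^ (q * m) :=
        Nat.mul_lt_mul_of_pos_right (Nat.pow_lt_pow_left Nat.lt_two_pow_self (by omega))
          (by positivity)
    _ ≤ 2 ^ (s * m) * 2 ^ (t * A) := by
        rw [← pow_mul, ← pow_add, ← pow_add, ← hN]
        refine Nat.pow_le_pow_right two_pos ?_
        have hA' : t * A = (t + 1) * m + t * (w + 2) * N := by ring
        have hqm : q * m = s * m + (t + 1) * m := by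
          rw [← add_mul, show q = s + (t + 1) by omega]
        have : 1 * N ≤ t * (w + 2) * N := Nat.mul_le_mul_right _ (Nat.mul_pos (by omega) (by omega))
        omega
end

section
/- For every integer q and every real s with 1 < s ≤ q, if α ∈ FEAS_q(s) is a local maximum point of OBJ_q on FEAS_q(s) (i.e., there exists ε > 0 such that OBJ_q(α) ≥ OBJ_q(α') for every α' ∈ FEAS_q(s) within distance ε of α), then E_q(α) = (s−1)/(2s). -/
/-- The nonempty subsets of `[q] = Fin q`, indexing the coordinates of our vectors. -/
def NEsets (q : ℕ) : Finset (Finset (Fin q)) :=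
  Finset.univ.filter (fun A => A.Nonempty)

/-- The objective function `OBJ_q(α) = Σ_{A ≠ ∅} α_A log |A|`. -/
noncomputable def objQ (q : ℕ) (α : Finset (Fin q) → ℝ) : ℝ :=
  ∑ A ∈ NEsets q, α A * Real.log (A.card : ℝ)

/-- The constraint function `V_q(α) = Σ_{A ≠ ∅} α_A`. -/
noncomputable def vQ (q : ℕ) (α : Finset (Fin q) → ℝ) : ℝ :=
  ∑ A ∈ NEsets q, α A

/-- The constraint function `E_q(α) = Σ_{{A,B} : A ∩ B = ∅} α_A α_B`, the sum being
over unordered pairs of disjoint nonempty sets. -/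
noncomputable def eQ (q : ℕ) (α : Finset (Fin q) → ℝ) : ℝ :=
  (1 / 2) * ∑ A ∈ NEsets q, ∑ B ∈ NEsets q,
    if Disjoint A B then α A * α B else 0

/-- The feasible set `FEAS_q(s)`: nonnegative vectors (indexed by nonempty subsets of
`[q]`, so the coordinate at `∅` is normalized to `0`) with `V_q(α) = 1` and
`E_q(α) ≥ (s-1)/(2s)`. -/
def Feas (q : ℕ) (s : ℝ) (α : Finset (Fin q) → ℝ) : Prop :=
  α ∅ = 0 ∧ (∀ A, 0 ≤ α A) ∧ vQ q α = 1 ∧ (s - 1) / (2 * s) ≤ eQ q α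

/-- `α` is a solution to `OPT_q(s)`: it is feasible and maximizes `OBJ_q` over
`FEAS_q(s)`. -/
def IsSolution (q : ℕ) (s : ℝ) (α : Finset (Fin q) → ℝ) : Prop :=
  Feas q s α ∧ ∀ β, Feas q s β → objQ q β ≤ objQ q α

/-- The support of `α`: the nonempty sets `A ⊆ [q]` with `α_A > 0`. -/
noncomputable def supp (q : ℕ) (α : Finset (Fin q) → ℝ) : Finset (Finset (Fin q)) :=
  @Finset.filter _ (fun A => 0 < α A) (Classical.decPred _) (NEsets q)

/-- `P` is a partition of `[q]` into nonempty parts. -/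
def IsPartitionOf (q : ℕ) (P : Finset (Finset (Fin q))) : Prop :=
  (∀ A ∈ P, A.Nonempty) ∧ (∀ A ∈ P, ∀ B ∈ P, A ≠ B → Disjoint A B) ∧
    P.biUnion id = Finset.univ

/-- `SUPP_q(α)` is in class `P_k`: the support of `α` is a partition of `[q]`
into `k` nonempty sets. -/
def ClassP (q k : ℕ) (α : Finset (Fin q) → ℝ) : Prop :=
  IsPartitionOf q (supp q α) ∧ (supp q α).card = k

/-- `SUPP_q(α)` is in class `Q_k`: the support of `α` consists of a partition
`A₁, …, A_k` of `[q]` into `k` nonempty sets together with the set `A₁ ∪ A₂`. -/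
def ClassQ (q k : ℕ) (α : Finset (Fin q) → ℝ) : Prop :=
  ∃ P : Finset (Finset (Fin q)), ∃ A₁ ∈ P, ∃ A₂ ∈ P, A₁ ≠ A₂ ∧
    IsPartitionOf q P ∧ P.card = k ∧ supp q α = insert (A₁ ∪ A₂) P

theorem mem_NEsets {q : ℕ} {A : Finset (Fin q)} : A ∈ NEsets q ↔ A.Nonempty := by
  simp [NEsets]

theorem continuous_eQ (q : ℕ) : Continuous (eQ q) := by
  unfold eQ
  refine continuous_const.mul (continuous_finsetSum _ fun A _ => continuous_finsetSum _ fun B _ => ?_)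
  split_ifs
  · exact (continuous_apply A).mul (continuous_apply B)
  · exact continuous_const

theorem vQ_lineMap (q : ℕ) (α γ : Finset (Fin q) → ℝ) (t : ℝ) :
    vQ q ((1 - t) • α + t • γ) = (1 - t) * vQ q α + t * vQ q γ := by
  simp [vQ, Finset.mul_sum, Finset.sum_add_distrib]

theorem objQ_lineMap (q : ℕ) (α γ : Finset (Fin q) → ℝ) (t : ℝ) :
    objQ q ((1 - t) • α + t • γ) = (1 - t) * objQ q α + t * objQ q γ := by
  simp [objQ, Finset.mul_sum, ← Finset.sum_add_distrib, add_mul, mul_assoc]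

/-- The objective is at most `log q`, and it attains this value only at the vector
concentrated on the full set `[q]`. -/
theorem eq_zero_of_log_le_objQ {q : ℕ} {α : Finset (Fin q) → ℝ} (hnonneg : ∀ A, 0 ≤ α A)
    (hV : vQ q α = 1) (hobj : Real.log q ≤ objQ q α) {A : Finset (Fin q)}
    (hA : A.Nonempty) (hAu : A ≠ Finset.univ) : α A = 0 := by
  have hterm : ∀ B ∈ NEsets q, 0 ≤ α B * (Real.log q - Real.log (B.card : ℝ)) := by
    intro B hB
    have hpos : (0 : ℝ) < B.card := by exact_mod_cast (mem_NEsets.1 hB).card_pos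
    have hle : (B.card : ℝ) ≤ q := by exact_mod_cast card_finset_fin_le B
    exact mul_nonneg (hnonneg B) (sub_nonneg.2 (Real.log_le_log hpos hle))
  have hsum : ∑ B ∈ NEsets q, α B * (Real.log q - Real.log (B.card : ℝ)) =
      Real.log q - objQ q α := by
    simp only [mul_sub, Finset.sum_sub_distrib, ← Finset.sum_mul]
    rw [show ∑ B ∈ NEsets q, α B = 1 from hV, one_mul, objQ]
  have hzero := (Finset.sum_eq_zero_iff_of_nonneg hterm).1
    (le_antisymm (by linarith) (Finset.sum_nonneg hterm)) A (mem_NEsets.2 hA)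
  have hpos : (0 : ℝ) < A.card := by exact_mod_cast hA.card_pos
  have hlt : (A.card : ℝ) < q := by
    have := (Finset.card_lt_iff_ne_univ A).2 hAu
    rw [Fintype.card_fin] at this
    exact_mod_cast this
  exact (mul_eq_zero.1 hzero).resolve_right (sub_pos.2 (Real.log_lt_log hpos hlt)).ne'

theorem eQ_eq_zero_of_concentrated {q : ℕ} {α : Finset (Fin q) → ℝ}
    (h : ∀ A : Finset (Fin q), A.Nonempty → A ≠ Finset.univ → α A = 0) : eQ q α = 0 := by
  unfold eQ
  refine mul_eq_zero_of_right _ (Finset.sum_eq_zero fun A hA => Finset.sum_eq_zero fun B hB => ?_)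
  split_ifs with hAB
  · by_cases hAu : A = Finset.univ
    · subst hAu
      have hB' := mem_NEsets.1 hB
      exact absurd (by simpa using hAB.mono_left (Finset.subset_univ B)) hB'.ne_empty
    · rw [h A (mem_NEsets.1 hA) hAu, zero_mul]
  · rfl

/-- At a local maximum of `OBJ_q` on `FEAS_q(s)`, the edge constraint is tight:
`E_q(α) = (s-1)/(2s)`. -/
theorem edge_constraint_tight (q : ℕ) (s : ℝ) (hs : 1 < s) (hsq : s ≤ q)
    (α : Finset (Fin q) → ℝ) (hα : Feas q s α)
    (hloc : ∃ ε : ℝ, 0 < ε ∧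
      ∀ β, Feas q s β → dist β α ≤ ε → objQ q β ≤ objQ q α) :
    eQ q α = (s - 1) / (2 * s) := by
  classical
  obtain ⟨hempty, hnonneg, hV, hE⟩ := hα
  obtain ⟨ε, hε, hmax⟩ := hloc
  by_contra hne
  have hslack : (s - 1) / (2 * s) < eQ q α := lt_of_le_of_ne hE (Ne.symm hne)
  have hq : 0 < q := by
    have : (0 : ℝ) < q := by linarith
    exact_mod_cast this
  have : NeZero q := ⟨hq.ne'⟩
  have hU : (Finset.univ : Finset (Fin q)) ∈ NEsets q := mem_NEsets.2 Finset.univ_nonempty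
  let γ : Finset (Fin q) → ℝ := Pi.single Finset.univ 1
  have hγV : vQ q γ = 1 := by simp [vQ, γ, Pi.single_apply, hU]
  have hγobj : objQ q γ = Real.log q := by simp [objQ, γ, Pi.single_apply, hU]
  have hγempty : γ ∅ = 0 := Pi.single_eq_of_ne Finset.univ_nonempty.ne_empty.symm 1
  have hγnonneg : ∀ A, 0 ≤ γ A := fun A =>
    (Pi.single_nonneg.2 zero_le_one : (0 : Finset (Fin q) → ℝ) ≤ γ) A
  have hcont : Continuous fun t : ℝ => (1 - t) • α + t • γ := by fun_prop
  have hEt : ∀ᶠ t in nhds (0 : ℝ), (s - 1) / (2 * s) < eQ q ((1 - t) • α + t • γ) :=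
    ((continuous_eQ q).comp hcont).continuousAt.eventually_const_lt (by simpa using hslack)
  have hdist : ∀ᶠ t in nhds (0 : ℝ), dist ((1 - t) • α + t • γ) α < ε :=
    (hcont.dist continuous_const).continuousAt.eventually_lt_const (by simpa using hε)
  obtain ⟨t, ⟨hEt, hdist, ht1⟩, ht0⟩ :=
    (((hEt.and (hdist.and (eventually_lt_nhds zero_lt_one))).filter_mono
      nhdsWithin_le_nhds).and (self_mem_nhdsWithin : Set.Ioi (0 : ℝ) ∈ _)).exists
  have ht0 : 0 < t := ht0
  have hfeas : Feas q s ((1 - t) • α + t • γ) := by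
    refine ⟨by simp [hempty, hγempty], fun A => ?_, ?_, hEt.le⟩
    · exact add_nonneg (mul_nonneg (sub_nonneg.2 ht1.le) (hnonneg A))
        (mul_nonneg ht0.le (hγnonneg A))
    · rw [vQ_lineMap, hV, hγV]
      ring
  have hobj := hmax _ hfeas hdist.le
  rw [objQ_lineMap, hγobj] at hobj
  have hlog : Real.log q ≤ objQ q α := le_of_mul_le_mul_left (by linarith) ht0
  have hE0 : eQ q α = 0 := eQ_eq_zero_of_concentrated fun _ =>
    eq_zero_of_log_le_objQ hnonneg hV hlog
  have : 0 < (s - 1) / (2 * s) := div_pos (by linarith) (by linarith)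
  linarith
end

section
/- For every integer q and every real s with 1 < s ≤ q, every solution α to OPT_q(s) satisfies ⋃{A ⊆ [q] : A ≠ ∅, α_A > 0} = [q]; that is, the sets in the support of α cover all q colors. -/
theorem swap_nonempty_iff {q : ℕ} {A A' : Finset (Fin q)} (hA : A.Nonempty) (hA' : A'.Nonempty)
    (X : Finset (Fin q)) : (Equiv.swap A A' X).Nonempty ↔ X.Nonempty := by
  rw [Equiv.swap_apply_def]
  split_ifs with h h'
  · subst h; simp [hA, hA']
  · subst h'; simp [hA, hA']
  · rfl

/-- Reindexing a sum over nonempty sets along the transposition of two nonempty sets. -/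
theorem sum_NEsets_swap {q : ℕ} {A A' : Finset (Fin q)} (hA : A.Nonempty) (hA' : A'.Nonempty)
    (f : Finset (Fin q) → ℝ) :
    ∑ X ∈ NEsets q, f (Equiv.swap A A' X) = ∑ X ∈ NEsets q, f X :=
  Finset.sum_equiv (Equiv.swap A A')
    (fun X => by rw [mem_NEsets, mem_NEsets, swap_nonempty_iff hA hA']) (fun _ _ => rfl)

/-- If `α` vanishes on all sets containing `c`, then moving the weight of `A` to `insert c A`
does not decrease `eQ`. -/
theorem eQ_le_eQ_swap_insert {q : ℕ} {α : Finset (Fin q) → ℝ} {c : Fin q} {A : Finset (Fin q)}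
    (hα : ∀ X, 0 ≤ α X) (hc : ∀ X, c ∈ X → α X = 0) (hA : A.Nonempty) :
    eQ q α ≤ eQ q (fun X => α (Equiv.swap A (insert c A) X)) := by
  set σ := Equiv.swap A (insert c A) with hσ
  have hA' : (insert c A).Nonempty := Finset.insert_nonempty c A
  have key : ∑ X ∈ NEsets q, ∑ Y ∈ NEsets q, (if Disjoint X Y then α (σ X) * α (σ Y) else 0) =
      ∑ X ∈ NEsets q, ∑ Y ∈ NEsets q, if Disjoint (σ X) (σ Y) then α X * α Y else 0 := by
    rw [← sum_NEsets_swap hA hA']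
    refine Finset.sum_congr rfl fun X _ => ?_
    rw [← sum_NEsets_swap hA hA']
    refine Finset.sum_congr rfl fun Y _ => ?_
    simp [hσ]
  unfold eQ
  rw [key]
  refine mul_le_mul_of_nonneg_left ?_ (by norm_num)
  refine Finset.sum_le_sum fun X hX => Finset.sum_le_sum fun Y _ => ?_
  have h0 : 0 ≤ α X * α Y := mul_nonneg (hα X) (hα Y)
  by_cases hd : Disjoint X Y
  swap
  · rw [if_neg hd]; split_ifs <;> simp [h0]
  by_cases hcX : c ∈ X
  · simp [hc X hcX]
  by_cases hcY : c ∈ Y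
  · simp [hc Y hcY]
  have hXA' : X ≠ insert c A := by rintro rfl; simp at hcX
  have hYA' : Y ≠ insert c A := by rintro rfl; simp at hcY
  have hd' : Disjoint (σ X) (σ Y) := by
    rw [hσ, Equiv.swap_apply_def, Equiv.swap_apply_def, if_neg hXA', if_neg hYA']
    split_ifs with h1 h2 h2
    · subst h1 h2
      exact absurd (disjoint_self.1 hd) hA.ne_empty
    · subst h1; simp [hd, hcY]
    · subst h2; simp [hd, hcX]
    · exact hd
  rw [if_pos hd, if_pos hd']

/-- If `α` vanishes on all sets containing `c` and `α A > 0`, then moving the weight of `A` to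
`insert c A` strictly increases `objQ`. -/
theorem objQ_lt_objQ_swap_insert {q : ℕ} {α : Finset (Fin q) → ℝ} {c : Fin q}
    {A : Finset (Fin q)} (hc : ∀ X, c ∈ X → α X = 0) (hA : A.Nonempty) (hpos : 0 < α A) :
    objQ q α < objQ q (fun X => α (Equiv.swap A (insert c A) X)) := by
  have hA' : (insert c A).Nonempty := Finset.insert_nonempty c A
  have hcA : c ∉ A := fun h => hpos.ne' (hc A h)
  have key : objQ q (fun X => α (Equiv.swap A (insert c A) X)) =
      ∑ X ∈ NEsets q, α X * Real.log ((Equiv.swap A (insert c A) X).card : ℝ) := by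
    unfold objQ
    rw [← sum_NEsets_swap hA hA' (fun X => α X * _)]
    simp
  rw [key]
  have hlt : α A * Real.log (A.card : ℝ) <
      α A * Real.log ((Equiv.swap A (insert c A) A).card : ℝ) := by
    rw [Equiv.swap_apply_left, Finset.card_insert_of_notMem hcA]
    refine mul_lt_mul_of_pos_left (Real.log_lt_log ?_ ?_) hpos
    · exact_mod_cast hA.card_pos
    · push_cast; linarith
  refine Finset.sum_lt_sum (fun X _ => ?_) ⟨A, mem_NEsets.2 hA, hlt⟩
  by_cases hcX : c ∈ X
  · simp [hc X hcX]
  have hXA' : X ≠ insert c A := by rintro rfl; simp at hcX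
  by_cases hXA : X = A
  · subst hXA; exact hlt.le
  · rw [Equiv.swap_apply_of_ne_of_ne hXA hXA']

/-- For any solution `α` to `OPT_q(s)`, the sets in the support of `α` cover all
`q` colors: `⋃ {A : α_A > 0} = [q]`. -/
theorem support_covers (q : ℕ) (s : ℝ) (hs : 1 < s) (hsq : s ≤ q)
    (α : Finset (Fin q) → ℝ) (hα : IsSolution q s α) :
    (supp q α).biUnion id = Finset.univ := by
  obtain ⟨⟨h0, hnn, hV, hE⟩, hmax⟩ := hα
  refine Finset.eq_univ_iff_forall.2 fun c => ?_
  by_contra hcov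
  have hc : ∀ X, c ∈ X → α X = 0 := by
    intro X hX
    by_contra hne
    refine hcov (Finset.mem_biUnion.2 ⟨X, ?_, hX⟩)
    unfold supp
    exact Finset.mem_filter.2 ⟨mem_NEsets.2 ⟨c, hX⟩, (hnn X).lt_of_ne' hne⟩
  obtain ⟨A, hA, hApos⟩ : ∃ A ∈ NEsets q, 0 < α A := by
    refine Finset.exists_lt_of_sum_lt (f := fun _ => (0 : ℝ)) ?_
    have : ∑ A ∈ NEsets q, α A = 1 := hV
    simp [this]
  have hA := mem_NEsets.1 hA
  have hA' : (insert c A).Nonempty := Finset.insert_nonempty c A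
  refine (objQ_lt_objQ_swap_insert hc hA hApos).not_ge (hmax _ ⟨?_, fun X => hnn _, ?_, ?_⟩)
  · simpa [Equiv.swap_apply_of_ne_of_ne hA.ne_empty.symm hA'.ne_empty.symm] using h0
  · exact (sum_NEsets_swap hA hA' α).trans hV
  · exact hE.trans (eQ_le_eQ_swap_insert hnn hc hA)
end

section
/- For every integer q and every real s with 1 < s ≤ q, let α be a solution to OPT_q(s), and suppose A, B ⊆ [q] are two sets in the support of α with A ∩ B ≠ ∅. Then either A ⊆ B, or for every c ∈ A \ B there exists a set C in the support of α such that C ∩ B = ∅ and c ∈ C. -/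
/-- The pushforward of `α` along a map `f` of subsets of `[q]`. -/
def pushVec {q : ℕ} (f : Finset (Fin q) → Finset (Fin q)) (α : Finset (Fin q) → ℝ) :
    Finset (Fin q) → ℝ :=
  fun D => ∑ C ∈ NEsets q with f C = D, α C

theorem sum_pushVec_mul {q : ℕ} {f : Finset (Fin q) → Finset (Fin q)}
    (hf : ∀ C ∈ NEsets q, f C ∈ NEsets q) (α g : Finset (Fin q) → ℝ) :
    ∑ D ∈ NEsets q, pushVec f α D * g D = ∑ C ∈ NEsets q, α C * g (f C) := by
  rw [← Finset.sum_fiberwise_of_maps_to hf fun C => α C * g (f C)]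
  refine Finset.sum_congr rfl fun D _ => ?_
  rw [pushVec, Finset.sum_mul]
  refine Finset.sum_congr rfl fun C hC => ?_
  rw [(Finset.mem_filter.1 hC).2]

theorem eQ_eq_sum_mul (q : ℕ) (α : Finset (Fin q) → ℝ) :
    eQ q α = (1 / 2) * ∑ A ∈ NEsets q, α A *
      ∑ B ∈ NEsets q, α B * if Disjoint A B then 1 else 0 := by
  rw [eQ]
  congr 1
  refine Finset.sum_congr rfl fun A _ => ?_
  rw [Finset.mul_sum]
  refine Finset.sum_congr rfl fun B _ => ?_
  split_ifs <;> ring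

theorem eQ_pushVec {q : ℕ} {f : Finset (Fin q) → Finset (Fin q)}
    (hf : ∀ C ∈ NEsets q, f C ∈ NEsets q) (α : Finset (Fin q) → ℝ) :
    eQ q (pushVec f α) = (1 / 2) * ∑ A ∈ NEsets q, ∑ B ∈ NEsets q,
      if Disjoint (f A) (f B) then α A * α B else 0 := by
  rw [eQ_eq_sum_mul]
  simp_rw [sum_pushVec_mul hf α]
  congr 1
  refine Finset.sum_congr rfl fun A _ => ?_
  rw [Finset.mul_sum]
  refine Finset.sum_congr rfl fun B _ => ?_
  split_ifs <;> ring

theorem mem_supp {q : ℕ} {α : Finset (Fin q) → ℝ} {A : Finset (Fin q)} :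
    A ∈ supp q α ↔ A.Nonempty ∧ 0 < α A := by
  simp [supp, NEsets]

/-- A map preserving disjointness of pairs in the support of `α` preserves feasibility. -/
theorem Feas.pushVec {q : ℕ} {s : ℝ} {f : Finset (Fin q) → Finset (Fin q)}
    {α : Finset (Fin q) → ℝ} (hα : Feas q s α) (hf : ∀ C ∈ NEsets q, f C ∈ NEsets q)
    (hdisj : ∀ C ∈ supp q α, ∀ D ∈ supp q α, Disjoint C D → Disjoint (f C) (f D)) :
    Feas q s (pushVec f α) := by
  obtain ⟨-, hnn, hV, hE⟩ := hα
  refine ⟨?_, fun D => Finset.sum_nonneg fun C _ => hnn C, ?_, hE.trans ?_⟩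
  · refine Finset.sum_eq_zero fun C hC => ?_
    obtain ⟨hC, h⟩ := Finset.mem_filter.1 hC
    have := hf C hC
    simp [NEsets, h] at this
  · have := sum_pushVec_mul hf α fun _ => 1
    simp only [mul_one] at this
    exact this.trans hV
  · rw [eQ_pushVec hf, eQ]
    refine mul_le_mul_of_nonneg_left ?_ (by norm_num)
    refine Finset.sum_le_sum fun C hC => Finset.sum_le_sum fun D hD => ?_
    have hC' : C.Nonempty := (Finset.mem_filter.1 hC).2
    have hD' : D.Nonempty := (Finset.mem_filter.1 hD).2
    rcases (hnn C).eq_or_lt with h | h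
    · simp [← h]
    rcases (hnn D).eq_or_lt with h' | h'
    · simp [← h']
    by_cases hCD : Disjoint C D
    · simp [hCD, hdisj C (mem_supp.2 ⟨hC', h⟩) D (mem_supp.2 ⟨hD', h'⟩) hCD]
    · rw [if_neg hCD]
      split_ifs <;> positivity

/-- Every point outside a support set `B` of a solution lies in a support set disjoint
from `B`: otherwise the weight of `B` could be moved to `B ∪ {c}`. -/
theorem IsSolution.exists_mem_supp_disjoint {q : ℕ} {s : ℝ} {α : Finset (Fin q) → ℝ}
    (hα : IsSolution q s α) {B : Finset (Fin q)} (hB : B ∈ supp q α) {c : Fin q}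
    (hc : c ∉ B) : ∃ C ∈ supp q α, Disjoint C B ∧ c ∈ C := by
  by_contra! hno
  obtain ⟨hBne, hBpos⟩ := mem_supp.1 hB
  let f : Finset (Fin q) → Finset (Fin q) := fun C => if C = B then insert c B else C
  have hsub : ∀ C, C ⊆ f C := fun C => by
    by_cases h : C = B <;> simp [f, h]
  have hf : ∀ C ∈ NEsets q, f C ∈ NEsets q := fun C hC => by
    simp only [NEsets, Finset.mem_filter, Finset.mem_univ, true_and] at hC ⊢
    exact hC.mono (hsub C)
  have hfeas : Feas q s (pushVec f α) := by
    refine hα.1.pushVec hf fun C hC D hD hCD => ?_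
    by_cases h : C = B
    · subst h
      have hDC : D ≠ C := by
        rintro rfl
        exact hBne.ne_empty (disjoint_self.1 hCD)
      simp [f, hDC, Finset.disjoint_insert_left, hCD, hno D hD hCD.symm]
    · by_cases h' : D = B
      · subst h'
        simp [f, h, Finset.disjoint_insert_right, hCD, hno C hC hCD]
      · simpa [f, h, h'] using hCD
  refine (hα.2 _ hfeas).not_gt ?_
  rw [objQ, objQ, sum_pushVec_mul hf α fun D => Real.log (D.card : ℝ)]
  refine Finset.sum_lt_sum (fun C hC => ?_) ⟨B, by simpa [NEsets] using hBne, ?_⟩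
  · have hCpos : (0 : ℝ) < C.card := by
      exact_mod_cast (Finset.mem_filter.1 hC).2.card_pos
    refine mul_le_mul_of_nonneg_left (Real.log_le_log hCpos ?_) (hα.1.2.1 C)
    exact_mod_cast Finset.card_le_card (hsub C)
  · refine mul_lt_mul_of_pos_left (Real.log_lt_log ?_ ?_) hBpos
    · exact_mod_cast hBne.card_pos
    · simp [f, Finset.card_insert_of_notMem hc]

/-- If `A, B` are in the support of a solution `α` to `OPT_q(s)` and `A ∩ B ≠ ∅`,
then either `A ⊆ B`, or every `c ∈ A \ B` lies in some support set `C` disjoint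
from `B`. -/
theorem supp_intersecting (q : ℕ) (s : ℝ) (hs : 1 < s) (hsq : s ≤ q)
    (α : Finset (Fin q) → ℝ) (hα : IsSolution q s α) (A B : Finset (Fin q))
    (hA : A ∈ supp q α) (hB : B ∈ supp q α) (hAB : (A ∩ B).Nonempty) :
    A ⊆ B ∨ ∀ c ∈ A \ B, ∃ C ∈ supp q α, Disjoint C B ∧ c ∈ C := by
  exact Or.inr fun c hc => hα.exists_mem_supp_disjoint hB (Finset.mem_sdiff.1 hc).2
end

section
/- For every integer q and every real s with 1 < s ≤ q, let α be a solution to OPT_q(s) and let A_1, A_2, …, A_k be sets in the support of α. Define vectors 1, g, β ∈ ℝ^k by 1_i = 1, g_i = log|A_i|, and β_i = Σ_{X ⊆ [q], X ≠ ∅, X ∩ A_i = ∅} α_X for i = 1,…,k. Then the vectors 1, g, β are linearly dependent over ℝ. -/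
open Filter Topology in
/-- A positive number stays positive under a small perturbation in a given direction. -/
lemma eventually_add_mul_pos {a : ℝ} (ha : 0 < a) (b : ℝ) :
    ∀ᶠ ε in 𝓝[>] (0 : ℝ), 0 < a + ε * b := by
  have hc : ContinuousAt (fun ε : ℝ => a + ε * b) 0 := by fun_prop
  exact (hc.eventually_const_lt (by simpa using ha)).filter_mono nhdsWithin_le_nhds

/-- Linearly independent vectors admit a common vector with prescribed inner products. -/
lemma LinearIndependent.exists_sum_mul_eq {m n : Type*} [Fintype m] [Fintype n]
    {b : m → n → ℝ} (h : LinearIndependent ℝ b) (c : m → ℝ) :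
    ∃ v : n → ℝ, ∀ i, ∑ j, b i j * v j = c i := by
  have hr : LinearMap.range (Matrix.of b).mulVecLin = ⊤ := by
    apply Submodule.eq_top_of_finrank_eq
    rw [Module.finrank_fintype_fun_eq_card]
    exact LinearIndependent.rank_matrix (M := Matrix.of b) h
  obtain ⟨v, hv⟩ := LinearMap.range_eq_top.mp hr c
  exact ⟨v, congrFun hv⟩

lemma objQ_add_mul (q : ℕ) (α δ : Finset (Fin q) → ℝ) (ε : ℝ) :
    objQ q (fun X => α X + ε * δ X) = objQ q α + ε * objQ q δ := by
  simp only [objQ, Finset.mul_sum, ← Finset.sum_add_distrib]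
  exact Finset.sum_congr rfl fun _ _ => by ring

lemma vQ_add_mul (q : ℕ) (α δ : Finset (Fin q) → ℝ) (ε : ℝ) :
    vQ q (fun X => α X + ε * δ X) = vQ q α + ε * vQ q δ := by
  simp only [vQ, Finset.mul_sum, ← Finset.sum_add_distrib]

/-- The second-order expansion of the quadratic form `eQ`. -/
lemma eQ_add_mul (q : ℕ) (α δ : Finset (Fin q) → ℝ) (ε : ℝ) :
    eQ q (fun X => α X + ε * δ X) = eQ q α +
      ε * (∑ B ∈ NEsets q, δ B * ∑ X ∈ NEsets q, if Disjoint X B then α X else 0) +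
      ε ^ 2 * eQ q δ := by
  have hsymm : (∑ B ∈ NEsets q, δ B * ∑ X ∈ NEsets q, if Disjoint X B then α X else 0) =
      1 / 2 * ∑ A ∈ NEsets q, ∑ B ∈ NEsets q,
        if Disjoint A B then α A * δ B + δ A * α B else 0 := by
    have h₁ : (∑ B ∈ NEsets q, δ B * ∑ X ∈ NEsets q, if Disjoint X B then α X else 0) =
        ∑ A ∈ NEsets q, ∑ B ∈ NEsets q, if Disjoint A B then δ A * α B else 0 := by
      simp only [Finset.mul_sum, mul_ite, mul_zero, disjoint_comm]
    have h₂ : (∑ A ∈ NEsets q, ∑ B ∈ NEsets q, if Disjoint A B then δ A * α B else 0) =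
        ∑ A ∈ NEsets q, ∑ B ∈ NEsets q, if Disjoint A B then α A * δ B else 0 := by
      rw [Finset.sum_comm]
      refine Finset.sum_congr rfl fun A _ => Finset.sum_congr rfl fun B _ => ?_
      simp only [disjoint_comm, mul_comm]
    have h₃ : (∑ A ∈ NEsets q, ∑ B ∈ NEsets q,
          if Disjoint A B then α A * δ B + δ A * α B else 0) =
        (∑ A ∈ NEsets q, ∑ B ∈ NEsets q, if Disjoint A B then α A * δ B else 0) +
          ∑ A ∈ NEsets q, ∑ B ∈ NEsets q, if Disjoint A B then δ A * α B else 0 := by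
      simp only [← Finset.sum_add_distrib]
      refine Finset.sum_congr rfl fun A _ => Finset.sum_congr rfl fun B _ => ?_
      split_ifs <;> simp
    rw [h₁, h₃, h₂]
    ring
  rw [hsymm]
  simp only [eQ, Finset.mul_sum, ← Finset.sum_add_distrib]
  refine Finset.sum_congr rfl fun A _ => Finset.sum_congr rfl fun B _ => ?_
  split_ifs <;> ring

/-- If `δ` leaves `V` unchanged, increases `E` to first order and is supported where `α` is
positive, then it does not increase the objective at a solution `α`. -/
lemma IsSolution.objQ_nonpos {q : ℕ} {s : ℝ} {α δ : Finset (Fin q) → ℝ}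
    (hα : IsSolution q s α) (hsupp : ∀ X, δ X ≠ 0 → 0 < α X) (hV : vQ q δ = 0)
    (hE : 0 < ∑ B ∈ NEsets q, δ B * ∑ X ∈ NEsets q, if Disjoint X B then α X else 0) :
    objQ q δ ≤ 0 := by
  obtain ⟨⟨h0, hnn, hv, he⟩, hmax⟩ := hα
  have hpos : ∀ᶠ ε in nhdsWithin (0 : ℝ) (Set.Ioi 0), ∀ X, 0 ≤ α X + ε * δ X := by
    rw [Filter.eventually_all]
    intro X
    by_cases hX : δ X = 0
    · exact Filter.Eventually.of_forall fun _ => by simpa [hX] using hnn X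
    · exact (eventually_add_mul_pos (hsupp X hX) (δ X)).mono fun _ h => h.le
  obtain ⟨ε, ⟨hε, hεE⟩, hε0⟩ :=
    ((hpos.and (eventually_add_mul_pos hE (eQ q δ))).and self_mem_nhdsWithin).exists
  have hε0 : 0 < ε := hε0
  have hδ0 : δ ∅ = 0 := by
    by_contra h
    exact (hsupp ∅ h).ne' h0
  have hle := hmax (fun X => α X + ε * δ X) ⟨by simp [h0, hδ0], hε,
    by rw [vQ_add_mul, hv, hV]; ring, by rw [eQ_add_mul]; nlinarith [mul_pos hε0 hεE]⟩
  rw [objQ_add_mul] at hle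
  by_contra! h
  nlinarith [mul_pos hε0 h]

/-- For any solution `α` to `OPT_q(s)` and sets `A_1, …, A_k` in the support of `α`,
the vectors `1`, `(log|A_i|)_i` and `(Σ_{X ∩ A_i = ∅} α_X)_i` of `ℝ^k` are linearly
dependent over `ℝ`. -/
theorem lin_dep (q : ℕ) (s : ℝ) (hs : 1 < s) (hsq : s ≤ q)
    (α : Finset (Fin q) → ℝ) (hα : IsSolution q s α)
    (k : ℕ) (A : Fin k → Finset (Fin q)) (hmem : ∀ i, A i ∈ supp q α) :
    ¬ LinearIndependent ℝ
      ![(fun _ : Fin k => (1 : ℝ)),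
        (fun i : Fin k => Real.log (((A i).card : ℝ))),
        (fun i : Fin k =>
          ∑ X ∈ NEsets q, if Disjoint X (A i) then α X else 0)] := by
  intro hli
  have hA : ∀ i, A i ∈ NEsets q ∧ 0 < α (A i) := fun i => by simpa [supp] using hmem i
  obtain ⟨v, hv⟩ := hli.exists_sum_mul_eq ![0, 1, 1]
  have hv₀ : ∑ i, 1 * v i = 0 := hv 0
  have hv₁ : ∑ i, Real.log ((A i).card : ℝ) * v i = 1 := hv 1
  have hv₂ : ∑ i, (∑ X ∈ NEsets q, if Disjoint X (A i) then α X else 0) * v i = 1 := hv 2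
  let δ : Finset (Fin q) → ℝ := fun X => ∑ i, if A i = X then v i else 0
  have hsum : ∀ f : Finset (Fin q) → ℝ,
      ∑ X ∈ NEsets q, δ X * f X = ∑ i, f (A i) * v i := by
    intro f
    simp only [δ, Finset.sum_mul]
    rw [Finset.sum_comm]
    refine Finset.sum_congr rfl fun i _ => ?_
    simp [(hA i).1, mul_comm]
  have hobj : objQ q δ = 1 := by
    rw [objQ, hsum fun X => Real.log (X.card : ℝ), hv₁]
  have hV : vQ q δ = 0 := by
    simpa [vQ] using (hsum fun _ => 1).trans hv₀
  have hsupp : ∀ X, δ X ≠ 0 → 0 < α X := by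
    intro X hX
    obtain ⟨i, -, hi⟩ := Finset.exists_ne_zero_of_sum_ne_zero hX
    have hAX : A i = X := by
      by_contra h
      exact hi (if_neg h)
    exact hAX ▸ (hA i).2
  have hle := hα.objQ_nonpos hsupp hV
    (by rw [hsum fun B => ∑ X ∈ NEsets q, if Disjoint X B then α X else 0, hv₂]; norm_num)
  linarith
end

section
/- For every integer q and every real s with 1 < s ≤ q, and every solution α to OPT_q(s), there do not exist four distinct sets A, B, C, D in the support of α inducing a path A−B−C−D in SUPP_q(α) (i.e., A ∩ B = B ∩ C = C ∩ D = ∅ while A ∩ C, B ∩ D, and A ∩ D are nonempty) with |A| > |C| and |D| > |B|. -/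
/-- The symmetric bilinear form whose quadratic form is `2 * eQ`. -/
noncomputable def disjointForm (q : ℕ) (α β : Finset (Fin q) → ℝ) : ℝ :=
  ∑ A ∈ NEsets q, α A * ∑ B ∈ NEsets q, β B * if Disjoint A B then 1 else 0

/-- The direction moving weight `x` from `C` to `A` and weight `y` from `D` to `B`. -/
def transfer {q : ℕ} (A B C D : Finset (Fin q)) (x y : ℝ) (X : Finset (Fin q)) : ℝ :=
  x * ((if X = A then 1 else 0) - if X = C then 1 else 0) +
    y * ((if X = B then 1 else 0) - if X = D then 1 else 0)

lemma eQ_eq_disjointForm (q : ℕ) (α : Finset (Fin q) → ℝ) :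
    eQ q α = 1 / 2 * disjointForm q α α := by
  simp only [eQ, disjointForm, Finset.mul_sum, mul_ite, mul_one, mul_zero]

lemma eQ_add_smul (q : ℕ) (α v : Finset (Fin q) → ℝ) (t : ℝ) :
    eQ q (fun X => α X + t * v X) = eQ q α +
      t * (1 / 2 * (disjointForm q α v + disjointForm q v α)) + t ^ 2 * eQ q v := by
  simp only [eQ_eq_disjointForm, disjointForm, Finset.mul_sum, ← Finset.sum_add_distrib]
  refine Finset.sum_congr rfl fun A _ => Finset.sum_congr rfl fun B _ => ?_
  ring

lemma vQ_add_smul (q : ℕ) (α v : Finset (Fin q) → ℝ) (t : ℝ) :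
    vQ q (fun X => α X + t * v X) = vQ q α + t * vQ q v := by
  simp only [vQ, Finset.mul_sum, Finset.sum_add_distrib]

lemma objQ_add_smul (q : ℕ) (α v : Finset (Fin q) → ℝ) (t : ℝ) :
    objQ q (fun X => α X + t * v X) = objQ q α + t * objQ q v := by
  simp only [objQ, Finset.mul_sum, add_mul, mul_assoc, Finset.sum_add_distrib]

/-- Small perturbations along a direction supported in `supp q α` keep the support and keep all
coordinates nonnegative. -/
lemma eventually_perturb (q : ℕ) (α v : Finset (Fin q) → ℝ) (hα : ∀ X, 0 ≤ α X)
    (hv : ∀ X, v X ≠ 0 → 0 < α X) :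
    ∀ᶠ t in nhds (0 : ℝ), (∀ X, 0 ≤ α X + t * v X) ∧
      ∀ X, 0 < α X → 0 < α X + t * v X := by
  have pos : ∀ᶠ t in nhds (0 : ℝ), ∀ X, 0 < α X → 0 < α X + t * v X := by
    refine Filter.eventually_all.2 fun X => ?_
    by_cases h : 0 < α X
    · have hc : Continuous fun t : ℝ => α X + t * v X := by fun_prop
      filter_upwards [(hc.tendsto 0).eventually (lt_mem_nhds (by simpa using h))] with t ht _
      exact ht
    · exact Filter.Eventually.of_forall fun t h' => absurd h' h
  filter_upwards [pos] with t ht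
  refine ⟨fun X => ?_, ht⟩
  by_cases h : v X = 0
  · simpa [h] using hα X
  · exact (ht X (hv X h)).le

section transfer

variable {q : ℕ} {A B C D : Finset (Fin q)}

lemma sum_transfer_mul (hA : A ∈ NEsets q) (hB : B ∈ NEsets q) (hC : C ∈ NEsets q)
    (hD : D ∈ NEsets q) (x y : ℝ) (g : Finset (Fin q) → ℝ) :
    ∑ X ∈ NEsets q, transfer A B C D x y X * g X = x * (g A - g C) + y * (g B - g D) := by
  simp only [transfer, add_mul, mul_assoc, sub_mul, Finset.sum_add_distrib, ← Finset.mul_sum,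
    Finset.sum_sub_distrib, ite_mul, one_mul, zero_mul, Finset.sum_ite_eq', hA, hB, hC, hD, if_true]

lemma vQ_transfer (hA : A ∈ NEsets q) (hB : B ∈ NEsets q) (hC : C ∈ NEsets q)
    (hD : D ∈ NEsets q) (x y : ℝ) : vQ q (transfer A B C D x y) = 0 := by
  simpa [vQ] using sum_transfer_mul hA hB hC hD x y fun _ => 1

lemma objQ_transfer (hA : A ∈ NEsets q) (hB : B ∈ NEsets q) (hC : C ∈ NEsets q)
    (hD : D ∈ NEsets q) (x y : ℝ) : objQ q (transfer A B C D x y) =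
      x * (Real.log A.card - Real.log C.card) + y * (Real.log B.card - Real.log D.card) :=
  sum_transfer_mul hA hB hC hD x y fun X => Real.log X.card

lemma eQ_transfer (hA : A ∈ NEsets q) (hB : B ∈ NEsets q) (hC : C ∈ NEsets q)
    (hD : D ∈ NEsets q) (hAB : Disjoint A B) (hBC : Disjoint B C) (hCD : Disjoint C D)
    (hAC : ¬ Disjoint A C) (hBD : ¬ Disjoint B D) (hAD : ¬ Disjoint A D) (x y : ℝ) :
    eQ q (transfer A B C D x y) = x * y := by
  have self : ∀ X ∈ NEsets q, ¬ Disjoint X X := fun X hX => by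
    simpa [NEsets, Finset.nonempty_iff_ne_empty] using hX
  have key : disjointForm q (transfer A B C D x y) (transfer A B C D x y) = _ :=
    sum_transfer_mul hA hB hC hD x y _
  rw [eQ_eq_disjointForm, key]
  simp only [sum_transfer_mul hA hB hC hD, hAB, hAB.symm, hBC, hBC.symm, hCD, hCD.symm, hAC,
    hBD, hAD, disjoint_comm.not.1 hAC, disjoint_comm.not.1 hBD,
    disjoint_comm.not.1 hAD, self A hA, self B hB, self C hC, self D hD, if_true,
    if_false]
  ring

lemma transfer_ne_zero {x y : ℝ} {X : Finset (Fin q)} (h : transfer A B C D x y X ≠ 0) :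
    X = A ∨ X = B ∨ X = C ∨ X = D := by
  contrapose! h
  simp [transfer, h]

end transfer

/-- A positive definite perturbation increases a quadratic for arbitrarily small parameters. -/
lemma frequently_lt_quadratic (c b e : ℝ) (he : 0 < e) :
    ∃ᶠ t in nhds (0 : ℝ), c < c + t * b + t ^ 2 * e := by
  have sign : ∀ t : ℝ, t ≠ 0 → 0 ≤ t * b → c < c + t * b + t ^ 2 * e := fun t ht hb => by
    have : 0 < t ^ 2 * e := by positivity
    linarith
  rcases le_total 0 b with hb | hb
  · refine Filter.Frequently.filter_mono (f := nhdsWithin 0 (Set.Ioi 0))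
      (Filter.Eventually.frequently ?_) nhdsWithin_le_nhds
    filter_upwards [self_mem_nhdsWithin] with t ht
    exact sign t (ne_of_gt ht) (mul_nonneg (le_of_lt ht) hb)
  · refine Filter.Frequently.filter_mono (f := nhdsWithin 0 (Set.Iio 0))
      (Filter.Eventually.frequently ?_) nhdsWithin_le_nhds
    filter_upwards [self_mem_nhdsWithin] with t ht
    exact sign t (ne_of_lt ht) (mul_nonneg_of_nonpos_of_nonpos (le_of_lt ht) hb)

/-- If `β` satisfies the edge constraint strictly, no direction supported in its support
that preserves `vQ` increases the objective above the optimum. -/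
lemma IsSolution.objQ_lt_of_slack {q : ℕ} {s : ℝ} {α β w : Finset (Fin q) → ℝ}
    (hα : IsSolution q s α) (hβ0 : β ∅ = 0) (hβ : ∀ X, 0 ≤ β X) (hβV : vQ q β = 1)
    (hβE : (s - 1) / (2 * s) < eQ q β) (hw : ∀ X, w X ≠ 0 → 0 < β X) (hwV : vQ q w = 0)
    (hwobj : 0 < objQ q w) : objQ q β < objQ q α := by
  have slack : ∀ᶠ u in nhds (0 : ℝ), (s - 1) / (2 * s) < eQ q (fun X => β X + u * w X) := by
    simp only [eQ_add_smul]
    have hc : Continuous fun u : ℝ => eQ q β +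
        u * (1 / 2 * (disjointForm q β w + disjointForm q w β)) + u ^ 2 * eQ q w := by fun_prop
    exact (hc.tendsto 0).eventually (lt_mem_nhds (by simpa using hβE))
  have hev := (slack.and (eventually_perturb q β w hβ hw)).filter_mono
    (nhdsWithin_le_nhds (s := Set.Ioi 0))
  obtain ⟨u, ⟨huE, hu, -⟩, hu0⟩ := (hev.and self_mem_nhdsWithin).exists
  have hu0 : 0 < u := hu0
  have hw0 : w ∅ = 0 := by
    by_contra h
    exact (hw ∅ h).ne' hβ0
  have hle := hα.2 _ ⟨by simp [hβ0, hw0], hu, by rw [vQ_add_smul, hβV, hwV]; ring, huE.le⟩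
  rw [objQ_add_smul] at hle
  have := mul_pos hu0 hwobj
  linarith

/-- For any solution `α` to `OPT_q(s)`, there are no four distinct support sets
`A, B, C, D` inducing a path `A−B−C−D` in `SUPP_q(α)` with `|A| > |C|` and
`|D| > |B|`. -/
theorem no_unbalanced_induced_path (q : ℕ) (s : ℝ) (hs : 1 < s) (hsq : s ≤ q)
    (α : Finset (Fin q) → ℝ) (hα : IsSolution q s α) :
    ¬ ∃ A B C D : Finset (Fin q),
      A ∈ supp q α ∧ B ∈ supp q α ∧ C ∈ supp q α ∧ D ∈ supp q α ∧
      A ≠ B ∧ A ≠ C ∧ A ≠ D ∧ B ≠ C ∧ B ≠ D ∧ C ≠ D ∧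
      A ∩ B = ∅ ∧ B ∩ C = ∅ ∧ C ∩ D = ∅ ∧
      (A ∩ C).Nonempty ∧ (B ∩ D).Nonempty ∧ (A ∩ D).Nonempty ∧
      C.card < A.card ∧ B.card < D.card := by
  rintro ⟨A, B, C, D, hA, hB, hC, hD, -, -, -, -, -, -, hAB, hBC, hCD, hAC, hBD, hAD, hca, hbd⟩
  simp only [supp, Finset.mem_filter] at hA hB hC hD
  obtain ⟨hA, hαA⟩ := hA
  obtain ⟨hB, hαB⟩ := hB
  obtain ⟨hC, hαC⟩ := hC
  obtain ⟨hD, hαD⟩ := hD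
  obtain ⟨hα0, hαpos, hαV, hαE⟩ := hα.1
  have log_lt : ∀ X Y : Finset (Fin q), X ∈ NEsets q → X.card < Y.card →
      0 < Real.log Y.card - Real.log X.card := fun X Y hX h => by
    have hX : 0 < X.card := Finset.card_pos.2 (Finset.mem_filter.1 hX).2
    exact sub_pos.2 (Real.log_lt_log (by exact_mod_cast hX) (by exact_mod_cast h))
  have hx := log_lt B D hB hbd
  have hy := log_lt C A hC hca
  set x := Real.log D.card - Real.log B.card with hxdef
  set y := Real.log A.card - Real.log C.card with hydef
  have hsupp : ∀ (x y : ℝ) X, transfer A B C D x y X ≠ 0 → 0 < α X := fun x y X h => by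
    rcases transfer_ne_zero h with rfl | rfl | rfl | rfl <;> assumption
  have hvE : eQ q (transfer A B C D x y) = x * y :=
    eQ_transfer hA hB hC hD (Finset.disjoint_iff_inter_eq_empty.2 hAB)
      (Finset.disjoint_iff_inter_eq_empty.2 hBC) (Finset.disjoint_iff_inter_eq_empty.2 hCD)
      (Finset.not_disjoint_iff_nonempty_inter.2 hAC)
      (Finset.not_disjoint_iff_nonempty_inter.2 hBD)
      (Finset.not_disjoint_iff_nonempty_inter.2 hAD) x y
  have hvobj : objQ q (transfer A B C D x y) = 0 := by
    rw [objQ_transfer hA hB hC hD, hxdef, hydef]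
    ring
  obtain ⟨t, htE, ht, htpos⟩ := ((frequently_lt_quadratic (eQ q α) _ _
    (hvE ▸ mul_pos hx hy)).and_eventually
      (eventually_perturb q α _ hαpos (hsupp x y))).exists
  rw [← eQ_add_smul] at htE
  have hv0 : transfer A B C D x y ∅ = 0 := by
    by_contra h
    exact (hsupp x y ∅ h).ne' hα0
  have hlt := hα.objQ_lt_of_slack (w := transfer A B C D 1 0) (by simp [hα0, hv0]) ht
    (by rw [vQ_add_smul, hαV, vQ_transfer hA hB hC hD]; ring) (hαE.trans_lt htE)
    (fun X h => htpos X (hsupp 1 0 X h)) (vQ_transfer hA hB hC hD 1 0)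
    (by rw [objQ_transfer hA hB hC hD]; linarith)
  rw [objQ_add_smul, hvobj] at hlt
  linarith
end
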